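/- arXiv:2109.09527 — 7 statements merged into one kernel-verified Lean document; each statement's English description precedes it below -/
import Mathlib

section
/- The PageRank operator T is a contraction with Lipschitz constant d in the ℓ1 norm: for all p, q : V → ℝ, Σ_{u ∈ V} |T(p)(u) − T(q)(u)| ≤ d · Σ_{v ∈ V} |p(v) − q(v)|. -/
open Finset

theorem pagerank_contraction {V : Type*} [Fintype V] [Nonempty V]
    (E : V → V → Prop) [DecidableRel E]
    (hE : ∀ v, ∃ u, E v u)
    (outdeg : V → ℕ)
    (houtdeg : ∀ v, outdeg v = (Finset.univ.filter (fun u => E v u)).card)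
    (d : ℝ) (hd0 : 0 ≤ d) (hd1 : d < 1)
    (T : (V → ℝ) → V → ℝ)
    (hT : ∀ p u, T p u = (1 - d) / (Fintype.card V : ℝ) +
        d * ∑ v ∈ Finset.univ.filter (fun v => E v u), p v / (outdeg v : ℝ))
    (p q : V → ℝ) :
    ∑ u, |T p u - T q u| ≤ d * ∑ v, |p v - q v| := by
  have hdiff : ∀ u, T p u - T q u =
      d * ∑ v ∈ univ.filter (fun v => E v u), (p v - q v) / (outdeg v : ℝ) := by
    intro u
    simp only [hT, sub_div, sum_sub_distrib]
    ring
  have hpos : ∀ v, (outdeg v : ℝ) ≠ 0 := by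
    intro v
    obtain ⟨u, hu⟩ := hE v
    rw [houtdeg, Nat.cast_ne_zero]
    exact card_ne_zero_of_mem (mem_filter.2 ⟨mem_univ u, hu⟩)
  calc ∑ u, |T p u - T q u|
      ≤ ∑ u, d * ∑ v ∈ univ.filter (fun v => E v u), |p v - q v| / (outdeg v : ℝ) := by
        refine sum_le_sum fun u _ => ?_
        rw [hdiff, abs_mul, abs_of_nonneg hd0]
        refine mul_le_mul_of_nonneg_left ((abs_sum_le_sum_abs _ _).trans_eq ?_) hd0
        simp only [abs_div, Nat.abs_cast]
    _ = d * ∑ v, ∑ u ∈ univ.filter (fun u => E v u), |p v - q v| / (outdeg v : ℝ) := by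
        rw [← mul_sum]
        simp only [sum_filter]
        rw [sum_comm]
    _ = d * ∑ v, |p v - q v| := by
        congr 1
        refine sum_congr rfl fun v _ => ?_
        rw [sum_const, ← houtdeg, nsmul_eq_mul, mul_div_cancel₀ _ (hpos v)]
end

section
/- The PageRank operator T has exactly one fixed point: there exists a unique p* : V → ℝ such that for every u ∈ V, p*(u) = (1−d)/n + d · Σ_{v : (v,u) ∈ E} p*(v)/outdeg(v). -/
open Finset

/-- Distributing the mass of each vertex evenly along its outgoing edges does not increase the
`ℓ¹` norm. -/
theorem sum_abs_sum_div_outdeg_le {V : Type*} [Fintype V]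
    (E : V → V → Prop) [DecidableRel E] (hE : ∀ v, ∃ u, E v u) (x : V → ℝ) :
    ∑ u, |∑ v ∈ univ.filter (fun v => E v u), x v / ((univ.filter (fun w => E v w)).card : ℝ)|
      ≤ ∑ v, |x v| := by
  calc
    _ ≤ ∑ u, ∑ v ∈ univ.filter (fun v => E v u),
          |x v| / ((univ.filter (fun w => E v w)).card : ℝ) := by
      refine sum_le_sum fun u _ => (abs_sum_le_sum_abs _ _).trans_eq ?_
      simp only [abs_div, Nat.abs_cast]
    _ = ∑ v, ∑ u ∈ univ.filter (fun u => E v u),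
          |x v| / ((univ.filter (fun w => E v w)).card : ℝ) :=
      sum_comm' (by simp)
    _ = ∑ v, |x v| := by
      refine sum_congr rfl fun v _ => ?_
      obtain ⟨u, hu⟩ := hE v
      have hcard : ((univ.filter (fun w => E v w)).card : ℝ) ≠ 0 :=
        Nat.cast_ne_zero.mpr (card_ne_zero_of_mem (mem_filter.mpr ⟨mem_univ u, hu⟩))
      rw [sum_const, nsmul_eq_mul, mul_div_cancel₀ _ hcard]

theorem pagerank_unique_fixed_point {V : Type*} [Fintype V] [Nonempty V]
    (E : V → V → Prop) [DecidableRel E]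
    (hE : ∀ v, ∃ u, E v u)
    (outdeg : V → ℕ)
    (houtdeg : ∀ v, outdeg v = (Finset.univ.filter (fun u => E v u)).card)
    (d : ℝ) (hd0 : 0 ≤ d) (hd1 : d < 1)
    (T : (V → ℝ) → V → ℝ)
    (hT : ∀ p u, T p u = (1 - d) / (Fintype.card V : ℝ) +
        d * ∑ v ∈ Finset.univ.filter (fun v => E v u), p v / (outdeg v : ℝ)) :
    ∃! pstar : V → ℝ, ∀ u, pstar u = (1 - d) / (Fintype.card V : ℝ) +
        d * ∑ v ∈ Finset.univ.filter (fun v => E v u), pstar v / (outdeg v : ℝ) := by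
  obtain rfl : outdeg = fun v => (univ.filter (fun u => E v u)).card := funext houtdeg
  let L : (V → ℝ) →ₗ[ℝ] (V → ℝ) :=
    { toFun := fun p u => p u - d * ∑ v ∈ univ.filter (fun v => E v u),
        p v / ((univ.filter (fun w => E v w)).card : ℝ)
      map_add' := fun p q => by
        ext u
        simp only [Pi.add_apply, add_div, sum_add_distrib]
        ring
      map_smul' := fun c p => by
        ext u
        simp only [Pi.smul_apply, smul_eq_mul, mul_div_assoc, ← mul_sum, RingHom.id_apply]
        ring }
  have hinj : Function.Injective L := by
    refine (injective_iff_map_eq_zero L).mpr fun x hx => ?_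
    have hfix : ∀ u, x u = d * ∑ v ∈ univ.filter (fun v => E v u),
        x v / ((univ.filter (fun w => E v w)).card : ℝ) :=
      fun u => sub_eq_zero.mp (congrFun hx u)
    have hle : ∑ u, |x u| ≤ d * ∑ u, |x u| := by
      refine le_trans (le_of_eq ?_)
        (mul_le_mul_of_nonneg_left (sum_abs_sum_div_outdeg_le E hE x) hd0)
      rw [mul_sum]
      refine sum_congr rfl fun u _ => ?_
      conv_lhs => rw [hfix u]
      rw [abs_mul, abs_of_nonneg hd0]
    have hnonneg : 0 ≤ ∑ u, |x u| := sum_nonneg fun u _ => abs_nonneg (x u)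
    have hzero : ∑ u, |x u| = 0 := by nlinarith
    ext u
    exact abs_eq_zero.mp
      ((sum_eq_zero_iff_of_nonneg fun u _ => abs_nonneg (x u)).mp hzero u (mem_univ u))
  have hbij : Function.Bijective L := ⟨hinj, LinearMap.injective_iff_surjective.mp hinj⟩
  obtain ⟨p, hp, huniq⟩ := hbij.existsUnique fun _ => (1 - d) / (Fintype.card V : ℝ)
  exact ⟨p, fun u => sub_eq_iff_eq_add.mp (congrFun hp u),
    fun q hq => huniq q (funext fun u => sub_eq_iff_eq_add.mpr (hq u))⟩
end

section
/- Any two solutions of the PageRank fixed-point equation coincide: if p, q : V → ℝ both satisfy p(u) = (1−d)/n + d · Σ_{v : (v,u) ∈ E} p(v)/outdeg(v) and q(u) = (1−d)/n + d · Σ_{v : (v,u) ∈ E} q(v)/outdeg(v) for every u ∈ V, then p = q. -/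
open Finset

theorem sum_sum_div_outdeg {V : Type*} [Fintype V] (E : V → V → Prop) [DecidableRel E]
    (hE : ∀ v, ∃ u, E v u) (f : V → ℝ) :
    ∑ u, ∑ v ∈ Finset.univ.filter (fun v => E v u),
      f v / ((Finset.univ.filter (fun w => E v w)).card : ℝ) = ∑ v, f v := by
  simp_rw [Finset.sum_filter]
  rw [Finset.sum_comm]
  refine Finset.sum_congr rfl fun v _ => ?_
  obtain ⟨u, hu⟩ := hE v
  have hcard : ((Finset.univ.filter (fun w => E v w)).card : ℝ) ≠ 0 :=
    Nat.cast_ne_zero.mpr (Finset.card_ne_zero_of_mem (a := u) (by simpa using hu))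
  rw [← Finset.sum_filter, Finset.sum_const, nsmul_eq_mul, mul_div_cancel₀ _ hcard]

theorem pagerank_fixed_point_coincide {V : Type*} [Fintype V] [Nonempty V]
    (E : V → V → Prop) [DecidableRel E]
    (hE : ∀ v, ∃ u, E v u)
    (outdeg : V → ℕ)
    (houtdeg : ∀ v, outdeg v = (Finset.univ.filter (fun u => E v u)).card)
    (d : ℝ) (hd0 : 0 ≤ d) (hd1 : d < 1)
    (p q : V → ℝ)
    (hp : ∀ u, p u = (1 - d) / (Fintype.card V : ℝ) +
        d * ∑ v ∈ Finset.univ.filter (fun v => E v u), p v / (outdeg v : ℝ))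
    (hq : ∀ u, q u = (1 - d) / (Fintype.card V : ℝ) +
        d * ∑ v ∈ Finset.univ.filter (fun v => E v u), q v / (outdeg v : ℝ)) :
    p = q := by
  obtain rfl : outdeg = fun v => (Finset.univ.filter (fun u => E v u)).card := funext houtdeg
  have hle : ∀ u, |p u - q u| ≤ d * ∑ v ∈ Finset.univ.filter (fun v => E v u),
      |p v - q v| / ((Finset.univ.filter (fun w => E v w)).card : ℝ) := fun u => by
    have hsub : p u - q u = d * ∑ v ∈ Finset.univ.filter (fun v => E v u),
        (p v - q v) / ((Finset.univ.filter (fun w => E v w)).card : ℝ) := by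
      simp_rw [sub_div]
      rw [Finset.sum_sub_distrib, hp u, hq u]
      ring
    rw [hsub, abs_mul, abs_of_nonneg hd0]
    refine mul_le_mul_of_nonneg_left ((Finset.abs_sum_le_sum_abs _ _).trans_eq ?_) hd0
    simp_rw [abs_div, Nat.abs_cast]
  have hsum : ∑ u, |p u - q u| ≤ d * ∑ u, |p u - q u| :=
    (Finset.sum_le_sum fun u _ => hle u).trans_eq <| by
      rw [← Finset.mul_sum, sum_sum_div_outdeg E hE fun v => |p v - q v|]
  have hnonneg : 0 ≤ ∑ u, |p u - q u| := Finset.sum_nonneg fun u _ => abs_nonneg _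
  have hzero : ∑ u, |p u - q u| = 0 := by nlinarith
  funext u
  have hu := (Finset.sum_eq_zero_iff_of_nonneg fun u _ => abs_nonneg (p u - q u)).mp hzero u
    (Finset.mem_univ u)
  exact sub_eq_zero.mp (abs_eq_zero.mp hu)
end

section
/- The PageRank iteration terminates for any positive threshold: for every threshold θ > 0 and any starting vector pr_0 : V → ℝ, there exists N such that for all i ≥ N and all u ∈ V, |pr_{i+1}(u) − pr_i(u)| < θ, where pr_i = T^i(pr_0). -/
open Finset

/-- Splitting the mass of each vertex equally among its out-neighbours, and scaling by `d`,
contracts the `ℓ¹` distance by the factor `d`. -/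
theorem sum_abs_pagerank_sub_le {V : Type*} [Fintype V]
    (E : V → V → Prop) [DecidableRel E] (hE : ∀ v, ∃ u, E v u)
    {d : ℝ} (hd0 : 0 ≤ d) (c : ℝ) (p q : V → ℝ) :
    ∑ u, |(c + d * ∑ v with E v u, p v / (#{w | E v w} : ℝ)) -
        (c + d * ∑ v with E v u, q v / (#{w | E v w} : ℝ))| ≤ d * ∑ v, |p v - q v| := by
  calc _ ≤ ∑ u, d * ∑ v with E v u, |p v - q v| / (#{w | E v w} : ℝ) := by
        refine sum_le_sum fun u _ => ?_
        rw [add_sub_add_left_eq_sub, ← mul_sub, ← sum_sub_distrib, abs_mul, abs_of_nonneg hd0]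
        refine mul_le_mul_of_nonneg_left ((abs_sum_le_sum_abs _ _).trans_eq ?_) hd0
        exact sum_congr rfl fun v _ => by rw [← sub_div, abs_div, Nat.abs_cast]
    _ = d * ∑ v, |p v - q v| := by
        rw [← mul_sum]
        simp_rw [sum_filter]
        rw [sum_comm]
        congr 1
        refine sum_congr rfl fun v _ => ?_
        obtain ⟨u, hu⟩ := hE v
        have hcard : (#{w | E v w} : ℝ) ≠ 0 :=
          Nat.cast_ne_zero.mpr (card_ne_zero_of_mem (mem_filter.mpr ⟨mem_univ u, hu⟩))
        rw [← sum_filter, sum_const, nsmul_eq_mul, mul_div_cancel₀ _ hcard]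

theorem pagerank_terminates {V : Type*} [Fintype V] [Nonempty V]
    (E : V → V → Prop) [DecidableRel E]
    (hE : ∀ v, ∃ u, E v u)
    (outdeg : V → ℕ)
    (houtdeg : ∀ v, outdeg v = (Finset.univ.filter (fun u => E v u)).card)
    (d : ℝ) (hd0 : 0 ≤ d) (hd1 : d < 1)
    (T : (V → ℝ) → V → ℝ)
    (hT : ∀ p u, T p u = (1 - d) / (Fintype.card V : ℝ) +
        d * ∑ v ∈ Finset.univ.filter (fun v => E v u), p v / (outdeg v : ℝ))
    (θ : ℝ) (hθ : 0 < θ) (pr0 : V → ℝ) :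
    ∃ N : ℕ, ∀ i : ℕ, N ≤ i → ∀ u : V, |T^[i + 1] pr0 u - T^[i] pr0 u| < θ := by
  have contract (p q : V → ℝ) : ∑ u, |T p u - T q u| ≤ d * ∑ u, |p u - q u| := by
    simp_rw [hT, houtdeg]
    exact sum_abs_pagerank_sub_le E hE hd0 _ p q
  have bound (i : ℕ) :
      ∑ u, |T^[i + 1] pr0 u - T^[i] pr0 u| ≤ d ^ i * ∑ u, |T pr0 u - pr0 u| := by
    induction i with
    | zero => simp
    | succ i ih =>
      rw [Function.iterate_succ_apply' T (i + 1), Function.iterate_succ_apply' T i, pow_succ',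
        mul_assoc]
      rw [Function.iterate_succ_apply' T i] at ih
      exact (contract _ _).trans (mul_le_mul_of_nonneg_left ih hd0)
  have lim : Filter.Tendsto (fun i : ℕ => d ^ i * ∑ u, |T pr0 u - pr0 u|)
      Filter.atTop (nhds 0) := by
    simpa using (tendsto_pow_atTop_nhds_zero_of_lt_one hd0 hd1).mul_const _
  obtain ⟨N, hN⟩ := Filter.eventually_atTop.mp (lim.eventually_lt_const hθ)
  refine ⟨N, fun i hi u => ?_⟩
  exact (single_le_sum (f := fun u => |T^[i + 1] pr0 u - T^[i] pr0 u|)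
    (fun _ _ => abs_nonneg _) (mem_univ u)).trans_lt ((bound i).trans_lt (hN i hi))
end

section
/- The error of a mixed asynchronous PageRank update is at most the error of the corresponding synchronous update: if p, q : V → ℝ satisfy p(v) ≤ q(v) for every v ∈ V, and r : V → ℝ satisfies r(v) = p(v) or r(v) = q(v) for every v ∈ V, then for every u ∈ V, |T(r)(u) − T(p)(u)| ≤ |T(q)(u) − T(p)(u)|. -/
open Finset

theorem pagerank_mixed_error_le {V : Type*} [Fintype V] [Nonempty V]
    (E : V → V → Prop) [DecidableRel E]
    (hE : ∀ v, ∃ u, E v u)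
    (outdeg : V → ℕ)
    (houtdeg : ∀ v, outdeg v = (Finset.univ.filter (fun u => E v u)).card)
    (d : ℝ) (hd0 : 0 ≤ d) (hd1 : d < 1)
    (T : (V → ℝ) → V → ℝ)
    (hT : ∀ p u, T p u = (1 - d) / (Fintype.card V : ℝ) +
        d * ∑ v ∈ Finset.univ.filter (fun v => E v u), p v / (outdeg v : ℝ))
    (p q r : V → ℝ) (hpq : ∀ v, p v ≤ q v)
    (hr : ∀ v, r v = p v ∨ r v = q v) :
    ∀ u, |T r u - T p u| ≤ |T q u - T p u| := by
  have hmono : ∀ a b : V → ℝ, (∀ v, a v ≤ b v) → ∀ u, T a u ≤ T b u := by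
    intro a b hab u
    rw [hT, hT]
    gcongr with v
    exact hab v
  have hpr : ∀ v, p v ≤ r v := fun v => by
    rcases hr v with h | h <;> simp [h, hpq v]
  have hrq : ∀ v, r v ≤ q v := fun v => by
    rcases hr v with h | h <;> simp [h, hpq v]
  intro u
  exact abs_le_abs_of_nonneg (sub_nonneg.2 (hmono p r hpr u))
    (sub_le_sub_right (hmono r q hrq u) _)
end

section
/- The unique fixed point of the PageRank operator is a probability vector: if p* : V → ℝ satisfies p*(u) = (1−d)/n + d · Σ_{v : (v,u) ∈ E} p*(v)/outdeg(v) for every u ∈ V, then Σ_{u ∈ V} p*(u) = 1. -/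
open Finset

/-- Distributing each `p v` evenly over the out-neighbours of `v` preserves the total mass. -/
theorem sum_sum_div_card_outNeighbors {V : Type*} [Fintype V] (E : V → V → Prop) [DecidableRel E]
    (hE : ∀ v, ∃ u, E v u) (p : V → ℝ) :
    ∑ u, ∑ v ∈ univ.filter (fun v => E v u), p v / (#(univ.filter (fun w => E v w)) : ℝ) =
      ∑ v, p v := by
  simp_rw [sum_filter]
  rw [sum_comm]
  refine sum_congr rfl fun v _ => ?_
  obtain ⟨u, hu⟩ := hE v
  have hcard : (#(univ.filter (fun w => E v w)) : ℝ) ≠ 0 :=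
    Nat.cast_ne_zero.mpr (card_ne_zero_of_mem (mem_filter.mpr ⟨mem_univ u, hu⟩))
  rw [← sum_filter, sum_const, nsmul_eq_mul, mul_div_cancel₀ _ hcard]

theorem pagerank_fixed_point_sums_to_one {V : Type*} [Fintype V] [Nonempty V]
    (E : V → V → Prop) [DecidableRel E]
    (hE : ∀ v, ∃ u, E v u)
    (outdeg : V → ℕ)
    (houtdeg : ∀ v, outdeg v = (Finset.univ.filter (fun u => E v u)).card)
    (d : ℝ) (hd0 : 0 ≤ d) (hd1 : d < 1)
    (pstar : V → ℝ)
    (hfix : ∀ u, pstar u = (1 - d) / (Fintype.card V : ℝ) +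
        d * ∑ v ∈ Finset.univ.filter (fun v => E v u), pstar v / (outdeg v : ℝ)) :
    ∑ u, pstar u = 1 := by
  have hcard : (Fintype.card V : ℝ) ≠ 0 := Nat.cast_ne_zero.mpr Fintype.card_ne_zero
  have hsum : ∑ u, pstar u = (1 - d) + d * ∑ u, pstar u := by
    calc ∑ u, pstar u
        = ∑ u, ((1 - d) / (Fintype.card V : ℝ) +
            d * ∑ v ∈ univ.filter (fun v => E v u), pstar v / (outdeg v : ℝ)) :=
          sum_congr rfl fun u _ => hfix u
      _ = (1 - d) + d * ∑ u, pstar u := by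
          simp_rw [houtdeg]
          rw [sum_add_distrib, ← mul_sum, sum_sum_div_card_outNeighbors E hE, sum_const,
            card_univ, nsmul_eq_mul, mul_div_cancel₀ _ hcard]
  refine mul_left_cancel₀ (sub_ne_zero.mpr hd1.ne') ?_
  linear_combination hsum
end

section
/- An approximate fixed point of the PageRank operator is close to the true fixed point: if p* is a fixed point of T and p : V → ℝ satisfies Σ_{u ∈ V} |p(u) − T(p)(u)| ≤ ε for some ε ≥ 0, then Σ_{u ∈ V} |p(u) − p*(u)| ≤ ε/(1−d). Hence any vector at which the asynchronous algorithm's termination condition holds agrees with the sequential PageRank vector up to error ε/(1−d) in ℓ1 norm. -/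
open Finset

/-- Distributing the value of each vertex equally among its successors does not increase the
`ℓ¹` norm. -/
theorem sum_abs_sum_div_card_filter_le {V : Type*} [Fintype V] (E : V → V → Prop)
    [DecidableRel E] (x : V → ℝ) :
    ∑ u, |∑ v ∈ univ.filter (fun v => E v u), x v / (#{w | E v w} : ℝ)| ≤ ∑ v, |x v| := by
  calc
    _ ≤ ∑ u, ∑ v, if E v u then |x v| / (#{w | E v w} : ℝ) else 0 := by
        gcongr with u
        rw [← sum_filter]
        refine (abs_sum_le_sum_abs _ _).trans_eq ?_
        simp only [abs_div, Nat.abs_cast]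
    _ = ∑ v, #{w | E v w} * (|x v| / (#{w | E v w} : ℝ)) := by
        rw [sum_comm]
        simp only [← sum_filter, sum_const, nsmul_eq_mul]
    _ ≤ ∑ v, |x v| := by
        gcongr with v
        rcases eq_or_ne (#{w | E v w} : ℝ) 0 with h | h
        · simp [h]
        · rw [mul_div_cancel₀ _ h]

theorem pagerank_approx_fixed_point {V : Type*} [Fintype V] [Nonempty V]
    (E : V → V → Prop) [DecidableRel E]
    (hE : ∀ v, ∃ u, E v u)
    (outdeg : V → ℕ)
    (houtdeg : ∀ v, outdeg v = (Finset.univ.filter (fun u => E v u)).card)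
    (d : ℝ) (hd0 : 0 ≤ d) (hd1 : d < 1)
    (T : (V → ℝ) → V → ℝ)
    (hT : ∀ p u, T p u = (1 - d) / (Fintype.card V : ℝ) +
        d * ∑ v ∈ Finset.univ.filter (fun v => E v u), p v / (outdeg v : ℝ))
    (pstar : V → ℝ) (hfix : T pstar = pstar)
    (p : V → ℝ) (ε : ℝ) (hε : 0 ≤ ε)
    (happrox : ∑ u, |p u - T p u| ≤ ε) :
    ∑ u, |p u - pstar u| ≤ ε / (1 - d) := by
  have contraction : ∑ u, |T p u - T pstar u| ≤ d * ∑ u, |p u - pstar u| := by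
    calc
      _ = d * ∑ u, |∑ v ∈ univ.filter (fun v => E v u),
            (p v - pstar v) / (#{w | E v w} : ℝ)| := by
          rw [mul_sum]
          refine sum_congr rfl fun u _ => ?_
          simp only [hT, houtdeg, add_sub_add_left_eq_sub, ← mul_sub, ← sum_sub_distrib,
            ← sub_div, abs_mul, abs_of_nonneg hd0]
      _ ≤ _ := mul_le_mul_of_nonneg_left
          (sum_abs_sum_div_card_filter_le E fun v => p v - pstar v) hd0
  have triangle : ∑ u, |p u - pstar u| ≤ ∑ u, |p u - T p u| + ∑ u, |T p u - T pstar u| := by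
    rw [← sum_add_distrib, hfix]
    gcongr with u
    exact abs_sub_le _ _ _
  rw [le_div_iff₀ (sub_pos.2 hd1)]
  linarith
end
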